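/- For every real number x ≥ 1, one has ((1 − Φ(x))²/φ(x)) · ∫_{1}^{x} Φ(y)²/φ(y) dy ≤ 1/x². -/

import Mathlib

open Real MeasureTheory

/-- The standard normal density. -/
noncomputable def stdNormalPDF (x : ℝ) : ℝ := (Real.sqrt (2 * Real.pi))⁻¹ * Real.exp (-x ^ 2 / 2)

/-- The standard normal distribution function. -/
noncomputable def stdNormalCDF (x : ℝ) : ℝ := ∫ t in Set.Iic x, stdNormalPDF t

theorem stdNormalPDF_eq_gaussianPDFReal :
    stdNormalPDF = ProbabilityTheory.gaussianPDFReal 0 1 := by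
  ext x
  simp [stdNormalPDF, ProbabilityTheory.gaussianPDFReal]

theorem stdNormalPDF_pos (x : ℝ) : 0 < stdNormalPDF x := by
  unfold stdNormalPDF
  positivity

theorem integrable_stdNormalPDF : Integrable stdNormalPDF := by
  rw [stdNormalPDF_eq_gaussianPDFReal]
  exact ProbabilityTheory.integrable_gaussianPDFReal 0 1

theorem one_sub_stdNormalCDF (x : ℝ) :
    1 - stdNormalCDF x = ∫ t in Set.Ioi x, stdNormalPDF t := by
  have h := integral_add_compl (measurableSet_Iic (a := x)) integrable_stdNormalPDF
  have h1 : ∫ t, stdNormalPDF t = 1 := by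
    rw [stdNormalPDF_eq_gaussianPDFReal]
    exact ProbabilityTheory.integral_gaussianPDFReal_eq_one 0 one_ne_zero
  rw [h1, Set.compl_Iic] at h
  unfold stdNormalCDF
  linarith

theorem stdNormalCDF_nonneg (x : ℝ) : 0 ≤ stdNormalCDF x :=
  integral_nonneg fun t => (stdNormalPDF_pos t).le

theorem one_sub_stdNormalCDF_nonneg (x : ℝ) : 0 ≤ 1 - stdNormalCDF x := by
  rw [one_sub_stdNormalCDF]
  exact integral_nonneg fun t => (stdNormalPDF_pos t).le

theorem hasDerivAt_stdNormalPDF (x : ℝ) :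
    HasDerivAt stdNormalPDF (-(x * stdNormalPDF x)) x := by
  have h : HasDerivAt (fun y : ℝ => -y ^ 2 / 2) (-x) x := by
    refine ((hasDerivAt_pow 2 x).fun_neg.div_const 2).congr_deriv ?_
    norm_num
    ring
  refine (h.exp.const_mul (Real.sqrt (2 * Real.pi))⁻¹).congr_deriv ?_
  simp only [stdNormalPDF]
  ring

theorem tendsto_stdNormalPDF_atTop :
    Filter.Tendsto stdNormalPDF Filter.atTop (nhds 0) := by
  have h : Filter.Tendsto (fun y : ℝ => -y ^ 2 / 2) Filter.atTop Filter.atBot := by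
    have h2 : Filter.Tendsto (fun y : ℝ => y ^ 2 / 2) Filter.atTop Filter.atTop :=
      (Filter.tendsto_pow_atTop two_ne_zero).atTop_div_const two_pos
    simpa [Function.comp_def, neg_div] using Filter.tendsto_neg_atTop_atBot.comp h2
  have h3 := (Real.tendsto_exp_atBot.comp h).const_mul (Real.sqrt (2 * Real.pi))⁻¹
  rwa [mul_zero] at h3

/-- The upper Mills ratio bound for the standard normal tail. -/
theorem mul_one_sub_stdNormalCDF_le {x : ℝ} (hx : 0 < x) :
    x * (1 - stdNormalCDF x) ≤ stdNormalPDF x := by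
  have hd : ∀ t ∈ Set.Ici x, HasDerivAt (fun y => -stdNormalPDF y) (t * stdNormalPDF t) t := by
    intro t _
    simpa using (hasDerivAt_stdNormalPDF t).fun_neg
  have hpos : ∀ t ∈ Set.Ioi x, 0 ≤ t * stdNormalPDF t := fun t ht =>
    mul_nonneg (hx.trans ht).le (stdNormalPDF_pos t).le
  have hlim : Filter.Tendsto (fun y => -stdNormalPDF y) Filter.atTop (nhds 0) := by
    simpa using tendsto_stdNormalPDF_atTop.neg
  have hint := integrableOn_Ioi_deriv_of_nonneg' hd hpos hlim
  have heq := integral_Ioi_of_hasDerivAt_of_nonneg' hd hpos hlim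
  rw [one_sub_stdNormalCDF, ← integral_const_mul]
  calc ∫ t in Set.Ioi x, x * stdNormalPDF t
      ≤ ∫ t in Set.Ioi x, t * stdNormalPDF t :=
        setIntegral_mono_on (integrable_stdNormalPDF.const_mul x).integrableOn hint
          measurableSet_Ioi fun t ht =>
            mul_le_mul_of_nonneg_right (le_of_lt ht) (stdNormalPDF_pos t).le
    _ = stdNormalPDF x := by rw [heq]; ring

theorem integral_sq_stdNormalCDF_div_le {x : ℝ} (hx : 1 ≤ x) :
    ∫ y in (1 : ℝ)..x, stdNormalCDF y ^ 2 / stdNormalPDF y ≤ 1 / stdNormalPDF x := by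
  have hd : ∀ y : ℝ, HasDerivAt (fun y => (stdNormalPDF y)⁻¹) (y / stdNormalPDF y) y := by
    intro y
    have hy := (stdNormalPDF_pos y).ne'
    refine ((hasDerivAt_stdNormalPDF y).fun_inv hy).congr_deriv ?_
    field_simp
  have hcont : Continuous stdNormalPDF :=
    continuous_iff_continuousAt.2 fun y => (hasDerivAt_stdNormalPDF y).continuousAt
  have hint : IntervalIntegrable (fun y => y / stdNormalPDF y) volume 1 x :=
    (continuous_id.div hcont fun y => (stdNormalPDF_pos y).ne').intervalIntegrable 1 x
  have hle : ∫ y in (1 : ℝ)..x, stdNormalCDF y ^ 2 / stdNormalPDF y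
      ≤ ∫ y in (1 : ℝ)..x, y / stdNormalPDF y := by
    rw [intervalIntegral.integral_of_le hx, intervalIntegral.integral_of_le hx]
    refine integral_mono_of_nonneg
      (Filter.Eventually.of_forall fun y => div_nonneg (sq_nonneg _) (stdNormalPDF_pos y).le)
      hint.1 ((ae_restrict_mem measurableSet_Ioc).mono fun y hy => ?_)
    have h0 := stdNormalCDF_nonneg y
    have h1 := one_sub_stdNormalCDF_nonneg y
    exact div_le_div_of_nonneg_right (by nlinarith [hy.1]) (stdNormalPDF_pos y).le
  rw [intervalIntegral.integral_eq_sub_of_hasDerivAt (fun y _ => hd y) hint] at hle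
  have := inv_pos.2 (stdNormalPDF_pos 1)
  rw [one_div]
  linarith

theorem stmt_6 (x : ℝ) (hx : 1 ≤ x) :
    (1 - stdNormalCDF x) ^ 2 / stdNormalPDF x *
        ∫ y in (1 : ℝ)..x, stdNormalCDF y ^ 2 / stdNormalPDF y ≤ 1 / x ^ 2 := by
  have hx0 : 0 < x := by linarith
  have hp := stdNormalPDF_pos x
  have hm := mul_one_sub_stdNormalCDF_le hx0
  have hq := one_sub_stdNormalCDF_nonneg x
  calc _ ≤ (1 - stdNormalCDF x) ^ 2 / stdNormalPDF x * (1 / stdNormalPDF x) :=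
        mul_le_mul_of_nonneg_left (integral_sq_stdNormalCDF_div_le hx) (by positivity)
    _ = ((1 - stdNormalCDF x) / stdNormalPDF x) ^ 2 := by field_simp
    _ ≤ (1 / x) ^ 2 := by
        refine pow_le_pow_left₀ (by positivity) ?_ 2
        rw [div_le_div_iff₀ hp hx0]
        linarith
    _ = 1 / x ^ 2 := by rw [div_pow, one_pow]
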